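/- Let C be a closed S-free convex set containing f in its interior, and let K = C − f. Then there exist k ≥ 1 and vectors a_1,…,a_k ∈ cl(conv(K̂)) such that B = {x ∈ ℝⁿ : a_i·(x − f) ≤ 1, i = 1,…,k} is a maximal S-free convex set. -/

import Mathlib

open scoped BigOperators Pointwise

noncomputable section

/-- Euclidean space `ℝⁿ`. -/
abbrev E (n : ℕ) := EuclideanSpace ℝ (Fin n)

/-- Dot product on `ℝⁿ`. -/
def dot {n : ℕ} (x y : E n) : ℝ := ∑ i, x i * y i

/-- A point with integral coordinates. -/
def IsIntPt {n : ℕ} (x : E n) : Prop := ∀ i, ∃ m : ℤ, x i = (m : ℝ)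

/-- A vector with rational coordinates. -/
def IsRatVec {n : ℕ} (x : E n) : Prop := ∀ i, ∃ q : ℚ, x i = (q : ℝ)

/-- `S` is the set of integral points of a rational polyhedron `{x | Ax ≤ b}`. -/
def IsIntPtsOfRatPolyhedron {n : ℕ} (S : Set (E n)) : Prop :=
  ∃ (m : ℕ) (A : Fin m → E n) (b : Fin m → ℝ),
    (∀ i, IsRatVec (A i)) ∧ (∀ i, ∃ q : ℚ, b i = (q : ℝ)) ∧
    S = {x | IsIntPt x ∧ ∀ i, dot (A i) x ≤ b i}

/-- `dim S = n`: `S` contains `n+1` affinely independent points. -/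
def FullDimSet {n : ℕ} (S : Set (E n)) : Prop :=
  ∃ p : Fin (n + 1) → E n, (∀ i, p i ∈ S) ∧ AffineIndependent ℝ p

/-- `B` is `S`-free: the interior of `B` contains no point of `S`. -/
def SFree {n : ℕ} (S B : Set (E n)) : Prop := ∀ x ∈ interior B, x ∉ S

/-- `B` is a maximal `S`-free convex set. -/
def MaxSFree {n : ℕ} (S B : Set (E n)) : Prop :=
  Convex ℝ B ∧ SFree S B ∧
    ∀ C : Set (E n), Convex ℝ C → SFree S C → B ⊆ C → B = C

/-- `B` is lattice-free: no integral point in its interior. -/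
def LatticeFree {n : ℕ} (B : Set (E n)) : Prop := ∀ x ∈ interior B, ¬ IsIntPt x

/-- `B` is a maximal lattice-free convex set. -/
def MaxLatticeFree {n : ℕ} (B : Set (E n)) : Prop :=
  Convex ℝ B ∧ LatticeFree B ∧
    ∀ C : Set (E n), Convex ℝ C → LatticeFree C → B ⊆ C → B = C

/-- A polyhedron: finite intersection of closed half-spaces. -/
def IsPolyhedron {n : ℕ} (B : Set (E n)) : Prop :=
  ∃ (m : ℕ) (a : Fin m → E n) (c : Fin m → ℝ), B = {x | ∀ i, dot (a i) x ≤ c i}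

/-- A polytope: convex hull of finitely many points. -/
def IsPolytope {n : ℕ} (P : Set (E n)) : Prop :=
  ∃ V : Finset (E n), P = convexHull ℝ (V : Set (E n))

/-- Dimension of a set: dimension of its affine hull. -/
def sdim {n : ℕ} (A : Set (E n)) : ℕ := Module.finrank ℝ (affineSpan ℝ A).direction

/-- `F` is a face of the convex set `B`. -/
def IsFaceOf {n : ℕ} (F B : Set (E n)) : Prop :=
  F ⊆ B ∧ Convex ℝ F ∧ ∀ x ∈ B, ∀ y ∈ B, ∀ t : ℝ, 0 < t → t < 1 →
    t • x + (1 - t) • y ∈ F → x ∈ F ∧ y ∈ F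

/-- `F` is a facet of `B`: a nonempty face of dimension `dim B - 1`. -/
def IsFacetOf {n : ℕ} (F B : Set (E n)) : Prop :=
  IsFaceOf F B ∧ F.Nonempty ∧ sdim F + 1 = sdim B

/-- Recession cone of `K`. -/
def recCone {n : ℕ} (K : Set (E n)) : Set (E n) :=
  {d | ∀ x ∈ K, ∀ t : ℝ, 0 ≤ t → x + t • d ∈ K}

/-- Lineality space of `K`. -/
def linSpace {n : ℕ} (K : Set (E n)) : Set (E n) :=
  {d | d ∈ recCone K ∧ -d ∈ recCone K}

/-- The set of all finite nonnegative combinations of elements of `G`. -/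
def conicHullOf {n : ℕ} (G : Set (E n)) : Set (E n) :=
  {x | ∃ (m : ℕ) (c : Fin m → ℝ) (v : Fin m → E n),
    (∀ i, 0 ≤ c i) ∧ (∀ i, v i ∈ G) ∧ x = ∑ i, c i • v i}

/-- A cone is rational if it is generated by vectors with rational coordinates. -/
def IsRationalCone {n : ℕ} (C : Set (E n)) : Prop :=
  ∃ G : Set (E n), (∀ v ∈ G, IsRatVec v) ∧ C = conicHullOf G

/-- A linear subspace is rational if it is spanned by rational vectors. -/
def IsRationalSubspace {n : ℕ} (L : Submodule ℝ (E n)) : Prop :=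
  ∃ G : Set (E n), (∀ v ∈ G, IsRatVec v) ∧ L = Submodule.span ℝ G

/-- The hyperplane `{x | a·x = β}` is a supporting hyperplane of `C`. -/
def IsSupportingHyperplane {n : ℕ} (a : E n) (β : ℝ) (C : Set (E n)) : Prop :=
  ((∀ x ∈ C, dot a x ≤ β) ∨ (∀ x ∈ C, β ≤ dot a x)) ∧
    ∃ x ∈ closure C, dot a x = β

/-- `ψ` is a valid function with respect to `f` and `S`. -/
def ValidFn {n : ℕ} (S : Set (E n)) (f : E n) (ψ : E n → ℝ) : Prop :=
  ∀ s : (E n) →₀ ℝ, (∀ r, 0 ≤ s r) →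
    (f + s.sum fun r c => c • r) ∈ S →
    1 ≤ s.sum fun r c => ψ r * c

/-- Sublinear: positively homogeneous and subadditive. -/
def Sublinear {n : ℕ} (ψ : E n → ℝ) : Prop :=
  (∀ t : ℝ, 0 ≤ t → ∀ r, ψ (t • r) = t * ψ r) ∧
  (∀ r r', ψ (r + r') ≤ ψ r + ψ r')

/-- Polar of `K`. -/
def polar {n : ℕ} (K : Set (E n)) : Set (E n) := {y | ∀ r ∈ K, dot y r ≤ 1}

/-- `K̂ = {y ∈ K* | ∃ x ∈ K, x·y = 1}`. -/
def Khat {n : ℕ} (K : Set (E n)) : Set (E n) :=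
  {y | y ∈ polar K ∧ ∃ x ∈ K, dot x y = 1}

/-- `ρ_K(r) = sup { y·r | y ∈ K̂ }`. -/
def rho {n : ℕ} (K : Set (E n)) (r : E n) : ℝ :=
  sSup ((fun y => dot y r) '' Khat K)


section Basics
variable {n : ℕ}

lemma dot_eq_inner (x y : E n) : dot x y = inner ℝ x y := by
  simp [dot, PiLp.inner_apply, mul_comm]

lemma dot_add_left (x y z : E n) : dot (x + y) z = dot x z + dot y z := by
  simp [dot_eq_inner, inner_add_left]
lemma dot_add_right (x y z : E n) : dot x (y + z) = dot x y + dot x z := by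
  simp [dot_eq_inner, inner_add_right]
lemma dot_sub_left (x y z : E n) : dot (x - y) z = dot x z - dot y z := by
  simp [dot_eq_inner, inner_sub_left]
lemma dot_sub_right (x y z : E n) : dot x (y - z) = dot x y - dot x z := by
  simp [dot_eq_inner, inner_sub_right]
lemma dot_smul_left (c : ℝ) (x y : E n) : dot (c • x) y = c * dot x y := by
  simp [dot_eq_inner, inner_smul_left]
lemma dot_smul_right (c : ℝ) (x y : E n) : dot x (c • y) = c * dot x y := by
  simp [dot_eq_inner, inner_smul_right]
lemma dot_comm' (x y : E n) : dot x y = dot y x := by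
  simp [dot_eq_inner, real_inner_comm]
lemma dot_zero_right (x : E n) : dot x 0 = 0 := by simp [dot_eq_inner]
lemma dot_zero_left (x : E n) : dot 0 x = 0 := by simp [dot_eq_inner]
lemma dot_le_norm (x y : E n) : dot x y ≤ ‖x‖ * ‖y‖ := by
  rw [dot_eq_inner]; exact real_inner_le_norm x y
lemma dot_self (x : E n) : dot x x = ‖x‖ ^ 2 := by
  rw [dot_eq_inner]; exact real_inner_self_eq_norm_sq x
lemma continuous_dot_right (a : E n) : Continuous (fun x : E n => dot a x) := by
  unfold dot; fun_prop
lemma continuous_dot_left (a : E n) : Continuous (fun x : E n => dot x a) := by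
  unfold dot; fun_prop

/-- `dot a` as a linear functional. -/
def dotL (a : E n) : E n →ₗ[ℝ] ℝ where
  toFun := fun x => dot a x
  map_add' := dot_add_right a
  map_smul' := fun c x => by simp [dot_smul_right]

lemma exists_dot_of_dual (g : StrongDual ℝ (E n)) : ∃ y : E n, ∀ x, g x = dot y x := by
  refine ⟨(InnerProductSpace.toDual ℝ (E n)).symm g, fun x => ?_⟩
  rw [dot_eq_inner, InnerProductSpace.toDual_symm_apply]

lemma convex_dot_le (v : E n) (c : ℝ) : Convex ℝ {a : E n | dot a v ≤ c} := by
  intro x hx y hy s t hs ht hst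
  simp only [Set.mem_ofPred_eq, dot_add_left, dot_smul_left] at *
  calc s * dot x v + t * dot y v ≤ s * c + t * c := by gcongr
    _ = c := by rw [← add_mul, hst, one_mul]

lemma convex_dot_lt (v : E n) (c : ℝ) : Convex ℝ {a : E n | dot a v < c} := by
  intro x hx y hy s t hs ht hst
  simp only [Set.mem_ofPred_eq, dot_add_left, dot_smul_left] at *
  rcases hs.eq_or_lt with rfl | hs
  · have : t = 1 := by linarith
    subst this; linarith
  · have h1 := mul_lt_mul_of_pos_left hx hs
    have h2 := mul_le_mul_of_nonneg_left hy.le ht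
    have h3 : s * c + t * c = c := by rw [← add_mul, hst, one_mul]
    linarith

end Basics

section Farkas
variable {V ι : Type*} [AddCommGroup V] [Module ℝ V]

lemma farkas_finset [DecidableEq ι] (s : Finset ι) : ∀ (g : ι → (V →ₗ[ℝ] ℝ)) (h : V →ₗ[ℝ] ℝ),
    (∀ r, (∀ i ∈ s, g i r ≤ 0) → h r ≤ 0) →
    ∃ μ : ι → ℝ, (∀ i, 0 ≤ μ i) ∧ ∀ r, h r = ∑ i ∈ s, μ i * g i r := by
  induction s using Finset.induction_on with
  | empty =>
    intro g h H
    refine ⟨fun _ => 0, fun _ => le_rfl, fun r => ?_⟩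
    have h1 := H r (by simp)
    have h2 := H (-r) (by simp)
    simp at h2 ⊢
    linarith
  | insert k s hk ih =>
    intro g h H
    by_cases hc : ∀ r, (∀ i ∈ s, g i r ≤ 0) → h r ≤ 0
    · obtain ⟨μ, hμ, hr⟩ := ih g h hc
      refine ⟨fun i => if i = k then 0 else μ i, fun i => by
        dsimp only; split_ifs; exacts [le_rfl, hμ i], fun r => ?_⟩
      rw [Finset.sum_insert hk, hr r]
      simp only [if_true, zero_mul, zero_add]
      refine Finset.sum_congr rfl fun i hi => ?_
      rw [if_neg (by rintro rfl; exact hk hi)]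
    · push Not at hc
      obtain ⟨r1, hr1, hh1⟩ := hc
      have hk1 : 0 < g k r1 := by
        by_contra hcon
        push Not at hcon
        have := H r1 (by
          intro i hi
          rcases Finset.mem_insert.1 hi with rfl | hi
          · exact hcon
          · exact hr1 i hi)
        linarith
      set r0 := (g k r1)⁻¹ • r1 with hr0
      have hk0 : g k r0 = 1 := by simp [hr0, hk1.ne']
      have hs0 : ∀ i ∈ s, g i r0 ≤ 0 := by
        intro i hi
        simp only [hr0, map_smul, smul_eq_mul]
        exact mul_nonpos_of_nonneg_of_nonpos (by positivity) (hr1 i hi)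
      have hh0 : 0 < h r0 := by
        simp only [hr0, map_smul, smul_eq_mul]
        positivity
      obtain ⟨μ, hμ, hr⟩ := ih (fun i => g i - (g i r0) • g k) (h - (h r0) • g k) (by
        intro r hr
        have := H (r - (g k r) • r0) (by
          intro i hi
          rcases Finset.mem_insert.1 hi with rfl | hi
          · simp [hk0]
          · have := hr i hi
            simp only [LinearMap.sub_apply, LinearMap.smul_apply, smul_eq_mul, map_sub,
              map_smul] at this ⊢
            linarith)
        simp only [LinearMap.sub_apply, LinearMap.smul_apply, smul_eq_mul, map_sub,
              map_smul] at this ⊢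
        linarith)
      refine ⟨fun i => if i = k then h r0 - ∑ j ∈ s, μ j * g j r0 else μ i, fun i => ?_,
        fun r => ?_⟩
      · dsimp only
        split_ifs
        · have : ∑ j ∈ s, μ j * g j r0 ≤ 0 :=
            Finset.sum_nonpos fun j hj => mul_nonpos_of_nonneg_of_nonpos (hμ j) (hs0 j hj)
          linarith
        · exact hμ i
      · rw [Finset.sum_insert hk]
        have h1 := hr r
        simp only [LinearMap.sub_apply, LinearMap.smul_apply, smul_eq_mul, mul_sub,
          Finset.sum_sub_distrib] at h1
        have h2 : ∑ i ∈ s, (if i = k then h r0 - ∑ j ∈ s, μ j * g j r0 else μ i) * g i r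
            = ∑ i ∈ s, μ i * g i r := by
          refine Finset.sum_congr rfl fun i hi => ?_
          rw [if_neg (by rintro rfl; exact hk hi)]
        rw [h2]
        simp only [if_true, sub_mul, Finset.sum_mul]
        have h3 : ∑ i ∈ s, μ i * (g i r0 * g k r) = ∑ i ∈ s, μ i * g i r0 * g k r :=
          Finset.sum_congr rfl fun i hi => by ring
        linarith

end Farkas

section Doignon
variable {n : ℕ}

lemma intPt_mid_of_parity {x y : E n} (hx : ∀ i, ∃ m : ℤ, x i = m) (hy : ∀ i, ∃ m : ℤ, y i = m)
    (h : ∀ i, (⌊x i⌋ % 2 = ⌊y i⌋ % 2)) : IsIntPt ((1/2 : ℝ) • (x + y)) := by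
  intro i
  obtain ⟨p, hp⟩ := hx i
  obtain ⟨q, hq⟩ := hy i
  have := h i
  rw [hp, hq, Int.floor_intCast, Int.floor_intCast] at this
  refine ⟨(p + q) / 2, ?_⟩
  obtain ⟨c, hc⟩ : ∃ c, p + q = 2 * c := ⟨(p + q) / 2, by omega⟩
  have h2 : (p + q) / 2 = c := by omega
  have h3 : (p : ℝ) + q = 2 * c := by exact_mod_cast hc
  rw [h2]
  simp [hp, hq]
  linarith

lemma doignon_fin (S0 : Set (E n)) (hfin : S0.Finite) (hintPt : ∀ s ∈ S0, IsIntPt s)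
    (hmid : ∀ x ∈ S0, ∀ y ∈ S0, IsIntPt ((1/2 : ℝ) • (x + y)) → (1/2 : ℝ) • (x + y) ∈ S0)
    (f : E n) (D : Set (E n)) (hD : ∀ s ∈ S0, ∃ a ∈ D, 1 ≤ dot a (s - f)) :
    ∃ F : Finset (E n), (F : Set (E n)) ⊆ D ∧ F.card ≤ 2 ^ n ∧
      ∀ s ∈ S0, ∃ a ∈ F, 1 ≤ dot a (s - f) := by
  classical
  -- some finite cover
  have hex : ∃ k : ℕ, ∃ F : Finset (E n), (F : Set (E n)) ⊆ D ∧ F.card = k ∧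
      ∀ s ∈ S0, ∃ a ∈ F, 1 ≤ dot a (s - f) := by
    choose! g hg using hD
    refine ⟨_, hfin.toFinset.image g, ?_, rfl, fun s hs => ⟨g s, ?_, (hg s hs).2⟩⟩
    · intro a ha
      simp only [Finset.coe_image, Set.Finite.coe_toFinset] at ha
      obtain ⟨s, hs, rfl⟩ := ha
      exact (hg s hs).1
    · exact Finset.mem_image_of_mem _ (hfin.mem_toFinset.2 hs)
  obtain ⟨F, hFD, hFc, hF⟩ := Nat.find_spec hex
  have hmin := fun k hk => Nat.find_min hex (m := k) hk
  refine ⟨F, hFD, ?_, hF⟩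
  by_contra hcard
  push Not at hcard
  -- irredundancy
  have hirr : ∀ a ∈ F, ∃ s ∈ S0, ∀ b ∈ F, b ≠ a → dot b (s - f) < 1 := by
    intro a ha
    by_contra hcon
    push Not at hcon
    refine hmin (F.erase a).card ?_ ⟨F.erase a, ?_, rfl, ?_⟩
    · rw [← hFc]; exact Finset.card_erase_lt_of_mem ha
    · exact fun x hx => hFD (Finset.mem_of_mem_erase hx)
    · intro s hs
      obtain ⟨b, hb, hba, h⟩ := hcon s hs
      exact ⟨b, Finset.mem_erase.2 ⟨hba, hb⟩, h⟩
  -- pushing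
  let cand : E n → Finset ℝ := fun a => insert 1 (hfin.toFinset.image fun s => dot a (s - f))
  let Good : Set (F → ℝ) := {β | (∀ a : F, 1 ≤ β a) ∧ (∀ a : F, β a ∈ cand a) ∧
      ∀ s ∈ S0, ∃ a : F, β a ≤ dot (a : E n) (s - f)}
  have hGfin : Good.Finite := by
    refine (Fintype.piFinset (fun a : F => cand a)).finite_toSet.subset ?_
    intro β hβ
    simp only [Finset.mem_coe, Fintype.mem_piFinset]
    exact hβ.2.1
  have hGne : Good.Nonempty := by
    refine ⟨fun _ => 1, fun _ => le_rfl, fun a => Finset.mem_insert_self _ _, fun s hs => ?_⟩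
    obtain ⟨a, ha, h⟩ := hF s hs
    exact ⟨⟨a, ha⟩, h⟩
  obtain ⟨β, hβ⟩ := hGfin.exists_maximal hGne
  have hβG := hβ.prop
  have hpt : ∀ a : F, ∃ s ∈ S0, dot (a : E n) (s - f) = β a ∧
      ∀ b : F, b ≠ a → dot (b : E n) (s - f) < β b := by
    intro a
    let Sa : Set (E n) := {s | s ∈ S0 ∧ ∀ b : F, b ≠ a → dot (b : E n) (s - f) < β b}
    have hSa : Sa.Finite := hfin.subset fun s hs => hs.1
    have hSne : Sa.Nonempty := by
      obtain ⟨s, hs, h⟩ := hirr a a.2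
      exact ⟨s, hs, fun b hb => (h b b.2 (fun h => hb (Subtype.ext h))).trans_le (hβG.1 b)⟩
    obtain ⟨s, hs, hsm⟩ := Set.exists_min_image Sa (fun s => dot (a : E n) (s - f)) hSa hSne
    have hle : ∀ t ∈ Sa, β a ≤ dot (a : E n) (t - f) := by
      intro t ht
      obtain ⟨b, hb⟩ := hβG.2.2 t ht.1
      by_cases hba : b = a
      · subst hba; exact hb
      · exact absurd (ht.2 b hba) (not_lt.2 hb)
    refine ⟨s, hs.1, ?_, hs.2⟩
    let β' : F → ℝ := Function.update β a (dot (a : E n) (s - f))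
    have hββ' : β ≤ β' := by
      intro b
      by_cases hba : b = a
      · subst hba; simp only [β', Function.update_self]; exact hle s hs
      · simp [β', Function.update_of_ne hba]
    have hβ'G : β' ∈ Good := by
      refine ⟨fun b => (hβG.1 b).trans (hββ' b), fun b => ?_, fun t ht => ?_⟩
      · by_cases hba : b = a
        · subst hba
          simp only [β', Function.update_self, cand]
          exact Finset.mem_insert_of_mem
            (Finset.mem_image_of_mem (fun s => dot (b : E n) (s - f)) (hfin.mem_toFinset.2 hs.1))
        · simp only [β', Function.update_of_ne hba]; exact hβG.2.1 b
      · by_cases hta : t ∈ Sa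
        · exact ⟨a, by simp only [β', Function.update_self]; exact hsm t hta⟩
        · have : ∃ b : F, b ≠ a ∧ β b ≤ dot (b : E n) (t - f) := by
            by_contra hcon
            push Not at hcon
            exact hta ⟨ht, hcon⟩
          obtain ⟨b, hba, hb⟩ := this
          exact ⟨b, by simp only [β', Function.update_of_ne hba]; exact hb⟩
    have := hβ.le_of_ge hβ'G hββ' a
    simp only [β', Function.update_self] at this
    exact le_antisymm this (hle s hs)
  choose p hp0 hpe hpl using hpt
  -- pigeonhole on parities
  let par : F → (Fin n → Fin 2) := fun a i => ⟨(⌊(p a) i⌋ % 2).toNat, by omega⟩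
  have hcl : Fintype.card (Fin n → Fin 2) < Fintype.card F := by simpa using hcard
  obtain ⟨a, b, hab, hpar⟩ := Fintype.exists_ne_map_eq_of_card_lt par hcl
  have hI : IsIntPt ((1/2 : ℝ) • (p a + p b)) := by
    refine intPt_mid_of_parity (hintPt _ (hp0 a)) (hintPt _ (hp0 b)) fun i => ?_
    have := congrArg Fin.val (congrFun hpar i)
    simp only [par] at this
    omega
  obtain ⟨c, hc⟩ := hβG.2.2 _ (hmid _ (hp0 a) _ (hp0 b) hI)
  have hsplit : (1/2 : ℝ) • (p a + p b) - f = (1/2 : ℝ) • (p a - f) + (1/2 : ℝ) • (p b - f) := by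
    module
  rw [hsplit, dot_add_right, dot_smul_right, dot_smul_right] at hc
  by_cases hca : c = a
  · subst hca
    have := hpe c
    have := hpl b c hab
    linarith
  · have h1 := hpl a c hca
    by_cases hcb : c = b
    · subst hcb
      have := hpe c
      linarith
    · have := hpl b c hcb
      linarith

lemma finite_intPts_ball (R : ℝ) : {x : E n | IsIntPt x ∧ ‖x‖ ≤ R}.Finite := by
  have h : ({x : E n | IsIntPt x ∧ ‖x‖ ≤ R}) ⊆
      (fun z : Fin n → ℤ => (WithLp.toLp 2 (fun i => (z i : ℝ)) : E n)) ''
        (Set.Icc (fun _ => -⌈R⌉) (fun _ => ⌈R⌉)) := by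
    rintro x ⟨hx, hR⟩
    choose z hz using hx
    refine ⟨z, ?_, by ext i; simp [hz i]⟩
    have : ∀ i, |(z i : ℝ)| ≤ R := fun i => by
      rw [← hz i]
      exact (by simpa using PiLp.norm_apply_le x i : |x i| ≤ ‖x‖).trans hR
    constructor
    · intro i
      have h1 := (abs_le.1 (this i)).1
      have h2 := Int.le_ceil R
      have : (-⌈R⌉ : ℝ) ≤ z i := by linarith
      exact_mod_cast this
    · intro i
      have h1 := (abs_le.1 (this i)).2
      have h2 := Int.le_ceil R
      have : (z i : ℝ) ≤ ⌈R⌉ := by linarith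
      exact_mod_cast this
  exact ((Set.finite_Icc _ _).image _).subset h

lemma doignon (S : Set (E n)) (hintPt : ∀ s ∈ S, IsIntPt s)
    (hmid : ∀ x ∈ S, ∀ y ∈ S, IsIntPt ((1/2 : ℝ) • (x + y)) → (1/2 : ℝ) • (x + y) ∈ S)
    (hne : S.Nonempty)
    (f : E n) (D : Set (E n)) (hDc : IsCompact D) (hD : ∀ s ∈ S, ∃ a ∈ D, 1 ≤ dot a (s - f)) :
    ∃ b : Fin (2 ^ n) → E n, (∀ i, b i ∈ D) ∧ ∀ s ∈ S, ∃ i, 1 ≤ dot (b i) (s - f) := by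
  classical
  obtain ⟨s0, hs0⟩ := hne
  obtain ⟨d0, hd0, -⟩ := hD s0 hs0
  let T : ℕ → Set (Fin (2 ^ n) → E n) := fun R =>
    {b | (∀ i, b i ∈ D) ∧ ∀ s ∈ S, ‖s‖ ≤ R → ∃ i, 1 ≤ dot (b i) (s - f)}
  have hTclosed : ∀ R, IsClosed (T R) := by
    intro R
    have : T R = (⋂ i, {b | b i ∈ D}) ∩ ⋂ s ∈ {s | s ∈ S ∧ ‖s‖ ≤ R},
        ⋃ i, {b | 1 ≤ dot (b i) (s - f)} := by
      ext b; simp [T]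
    rw [this]
    refine (isClosed_iInter fun i => hDc.isClosed.preimage (continuous_apply i)).inter ?_
    refine isClosed_biInter fun s _ => isClosed_iUnion_of_finite fun i => ?_
    exact isClosed_le continuous_const ((continuous_dot_left (s - f)).comp (continuous_apply i))
  have hTc : IsCompact (T 0) := by
    refine (isCompact_univ_pi (fun _ : Fin (2 ^ n) => hDc)).of_isClosed_subset (hTclosed 0) ?_
    intro b hb i _
    exact hb.1 i
  have hTne : ∀ R, (T R).Nonempty := by
    intro R
    obtain ⟨F, hFD, hFc, hF⟩ := doignon_fin {s | s ∈ S ∧ ‖s‖ ≤ R}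
      ((finite_intPts_ball (R : ℝ)).subset fun s hs => ⟨hintPt s hs.1, hs.2⟩)
      (fun s hs => hintPt s hs.1)
      (fun x hx y hy h => ⟨hmid x hx.1 y hy.1 h, by
        rw [norm_smul]
        have := norm_add_le x y
        have := hx.2
        have := hy.2
        norm_num
        linarith⟩) f D (fun s hs => hD s hs.1)
    obtain ⟨e⟩ : Nonempty (F ↪ Fin (2 ^ n)) := by
      rw [Function.Embedding.nonempty_iff_card_le]; simpa using hFc
    refine ⟨fun i => if h : ∃ a, e a = i then (h.choose : E n) else d0, fun i => ?_,
      fun s hs hsR => ?_⟩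
    · dsimp only
      split_ifs with h
      · exact hFD h.choose.2
      · exact hd0
    · obtain ⟨a, ha, h⟩ := hF s ⟨hs, hsR⟩
      refine ⟨e ⟨a, ha⟩, ?_⟩
      have hh : ∃ a', e a' = e ⟨a, ha⟩ := ⟨_, rfl⟩
      dsimp only
      rw [dif_pos hh, e.injective hh.choose_spec]
      exact h
  obtain ⟨b, hb⟩ := IsCompact.nonempty_iInter_of_sequence_nonempty_isCompact_isClosed T
    (fun R b hb => ⟨hb.1, fun s hs h => hb.2 s hs (h.trans (by push_cast; linarith))⟩)
    hTne hTc hTclosed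
  rw [Set.mem_iInter] at hb
  refine ⟨b, (hb 0).1, fun s hs => ?_⟩
  exact (hb ⌈‖s‖⌉₊).2 s hs (Nat.le_ceil _)

end Doignon

section Approx
variable {n : ℕ}

lemma exists_pos_le_all {ι : Type*} [Finite ι] (g : ι → ℝ) (hg : ∀ i, 0 < g i) :
    ∃ e : ℝ, 0 < e ∧ ∀ i, e ≤ g i := by
  have h : ∀ᶠ e in nhdsWithin (0 : ℝ) (Set.Ioi 0), ∀ i, e ≤ g i := by
    rw [Filter.eventually_all]
    intro i
    filter_upwards [Ioo_mem_nhdsGT (hg i)] with e he using he.2.le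
  obtain ⟨e, he, h0⟩ := (h.and self_mem_nhdsWithin).exists
  exact ⟨e, h0, he⟩

lemma exists_nat_ge_all {ι : Type*} [Finite ι] (g : ι → ℕ) : ∃ T : ℕ, ∀ i, g i ≤ T := by
  obtain ⟨T, hT⟩ := (Set.finite_range g).bddAbove
  exact ⟨T, fun i => hT ⟨i, rfl⟩⟩

lemma dirichlet (r : E n) (ε : ℝ) (hε : 0 < ε) (T : ℕ) :
    ∃ k : ℕ, T ≤ k ∧ ∃ u : E n, IsIntPt u ∧ ‖u - (k : ℝ) • r‖ < ε := by
  let x : ℕ → E n := fun j => WithLp.toLp 2 (fun i => Int.fract ((j * (T + 1) : ℝ) * r i))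
  have hc : IsCompact ((fun v : Fin n → ℝ => (WithLp.toLp 2 v : E n)) ''
      (Set.univ.pi fun _ => Set.Icc (0 : ℝ) 1)) :=
    (isCompact_univ_pi fun _ => isCompact_Icc).image (PiLp.continuous_toLp 2 _)
  have hx : ∀ j, x j ∈ ((fun v : Fin n → ℝ => (WithLp.toLp 2 v : E n)) ''
      (Set.univ.pi fun _ => Set.Icc (0 : ℝ) 1)) := fun j =>
    ⟨_, fun i _ => ⟨Int.fract_nonneg _, (Int.fract_lt_one _).le⟩, rfl⟩
  obtain ⟨a, -, φ, hφ, hlim⟩ := hc.tendsto_subseq hx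
  obtain ⟨N, hN⟩ := Metric.tendsto_atTop.1 hlim (ε / 2) (by positivity)
  have h1 := hN N le_rfl
  have h2 := hN (N + 1) (by omega)
  have hd : dist (x (φ N)) (x (φ (N + 1))) < ε := by
    have := dist_triangle_right (x (φ N)) (x (φ (N + 1))) a
    simp only [Function.comp] at h1 h2
    linarith
  have hlt : φ N < φ (N + 1) := hφ (by omega)
  obtain ⟨c, hc⟩ := Nat.exists_eq_add_of_lt hlt
  refine ⟨(c + 1) * (T + 1), by nlinarith, WithLp.toLp 2 (fun i =>
    ((⌊((φ (N + 1) : ℝ) * (T + 1)) * r i⌋ - ⌊((φ N : ℝ) * (T + 1)) * r i⌋ : ℤ) : ℝ)),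
    fun i => ⟨_, rfl⟩, ?_⟩
  rw [dist_eq_norm] at hd
  refine lt_of_eq_of_lt (congrArg norm ?_) hd
  ext i
  simp only [x, PiLp.sub_apply, PiLp.smul_apply, smul_eq_mul, Int.fract]
  have : (φ (N + 1) : ℝ) = φ N + c + 1 := by rw [hc]; push_cast; ring
  push_cast
  rw [this]
  ring

lemma approx_lt (a r : E n) (c : ℝ) (har : dot a r ≤ 0) (hc : dot a r = 0 → 0 < c) :
    ∃ ε : ℝ, 0 < ε ∧ ∃ T : ℕ, ∀ k : ℕ, T ≤ k → ∀ u : E n, ‖u - (k : ℝ) • r‖ < ε →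
      dot a u < c := by
  have key : ∀ (k : ℕ) (u : E n) (ε : ℝ), ‖u - (k : ℝ) • r‖ < ε →
      dot a u ≤ k * dot a r + ‖a‖ * ε := by
    intro k u ε h
    have h1 := dot_le_norm a (u - (k : ℝ) • r)
    rw [dot_sub_right, dot_smul_right] at h1
    have h2 : ‖a‖ * ‖u - (k : ℝ) • r‖ ≤ ‖a‖ * ε := by gcongr
    linarith
  rcases har.eq_or_lt with h0 | h0
  · have hc := hc h0
    refine ⟨c / (‖a‖ + 1), by positivity, 0, fun k _ u hu => ?_⟩
    have h1 := key k u _ hu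
    rw [h0, mul_zero, zero_add] at h1
    refine h1.trans_lt ?_
    rw [mul_div_assoc', div_lt_iff₀ (by positivity)]
    nlinarith [norm_nonneg a]
  · obtain ⟨T, hT⟩ := exists_nat_gt ((‖a‖ + |c|) / (-dot a r))
    refine ⟨1, one_pos, T, fun k hk u hu => ?_⟩
    have h1 := key k u _ hu
    rw [div_lt_iff₀ (by linarith)] at hT
    have h2 : (T : ℝ) ≤ k := by exact_mod_cast hk
    have h3 := neg_abs_le c
    nlinarith

lemma exists_denom (a : E n) (ha : IsRatVec a) :
    ∃ q : ℕ, 0 < q ∧ ∀ u : E n, IsIntPt u → ∃ z : ℤ, (q : ℝ) * dot a u = z := by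
  choose p hp using ha
  refine ⟨∏ i, (p i).den, Finset.prod_pos fun i _ => (p i).den_pos, fun u hu => ?_⟩
  choose w hw using hu
  have h : ∀ i, ∃ z : ℤ, ((∏ i, (p i).den : ℕ) : ℝ) * (a i * u i) = z := by
    intro i
    obtain ⟨c, hc⟩ := Finset.dvd_prod_of_mem (fun i => (p i).den) (Finset.mem_univ i)
    refine ⟨c * (p i).num * w i, ?_⟩
    have h1 : ((p i : ℚ) : ℝ) * (p i).den = (p i).num := by exact_mod_cast Rat.mul_den_eq_num (p i)
    rw [hc, hp, hw]
    push_cast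
    rw [← h1]
    ring
  choose z hz using h
  refine ⟨∑ i, z i, ?_⟩
  rw [dot, Finset.mul_sum, Int.cast_sum]
  exact Finset.sum_congr rfl fun i _ => hz i

lemma rec_cover {m : ℕ} {ι : Type*} [Finite ι] (α : Fin m → E n) (β : Fin m → ℝ)
    (hα : ∀ l, IsRatVec (α l)) (f : E n) (b : ι → E n)
    (hcov : ∀ s, IsIntPt s → (∀ l, dot (α l) s ≤ β l) → ∃ j, 1 ≤ dot (b j) (s - f))
    (r : E n) (hr : ∀ l, dot (α l) r ≤ 0) (hb : ∀ j, dot (b j) r ≤ 0)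
    (s : E n) (hs : IsIntPt s) (hsα : ∀ l, dot (α l) s ≤ β l) :
    ∃ j, dot (b j) r = 0 ∧ 1 ≤ dot (b j) (s - f) := by
  by_contra hcon
  push Not at hcon
  choose q hq0 hq using fun l => exists_denom (α l) (hα l)
  choose ε1 hε1 T1 h1 using fun l => approx_lt (α l) r (1 / q l) (hr l)
    (fun _ => by have := hq0 l; positivity)
  choose ε2 hε2 T2 h2 using fun j => approx_lt (b j) r (1 - dot (b j) (s - f)) (hb j)
    (fun h => by have := hcon j h; linarith)
  obtain ⟨e1, he1, he1'⟩ := exists_pos_le_all ε1 hε1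
  obtain ⟨e2, he2, he2'⟩ := exists_pos_le_all ε2 hε2
  obtain ⟨t1, ht1⟩ := exists_nat_ge_all T1
  obtain ⟨t2, ht2⟩ := exists_nat_ge_all T2
  obtain ⟨k, hk, u, hu, hku⟩ := dirichlet r (min e1 e2) (lt_min he1 he2) (max t1 t2)
  have hαu : ∀ l, dot (α l) u ≤ 0 := by
    intro l
    have := h1 l k ((ht1 l).trans ((le_max_left _ _).trans hk)) u
      (hku.trans_le ((min_le_left _ _).trans (he1' l)))
    have hql : (0 : ℝ) < q l := by exact_mod_cast hq0 l
    rw [lt_div_iff₀ hql] at this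
    obtain ⟨z, hz⟩ := hq l u hu
    rw [mul_comm, hz] at this
    have hz1 : z < 1 := by exact_mod_cast this
    have hz0 : (z : ℝ) ≤ 0 := by exact_mod_cast (by omega : z ≤ 0)
    rw [← hz] at hz0
    by_contra hc
    push Not at hc
    have := mul_pos hql hc
    linarith
  obtain ⟨j, hj⟩ := hcov (s + u) (fun i => by
      obtain ⟨p, hp⟩ := hs i
      obtain ⟨p', hp'⟩ := hu i
      exact ⟨p + p', by simp [hp, hp']⟩) (fun l => by
      rw [dot_add_right]; linarith [hαu l, hsα l])
  have := h2 j k ((ht2 j).trans ((le_max_right _ _).trans hk)) u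
    (hku.trans_le ((min_le_right _ _).trans (he2' j)))
  rw [add_sub_right_comm, dot_add_right] at hj
  linarith

end Approx

section Polar
variable {n : ℕ}

lemma polar_compact (C : Set (E n)) (f : E n) (hf : f ∈ interior C) :
    IsCompact {y : E n | ∀ x ∈ C, dot y (x - f) ≤ 1} := by
  obtain ⟨δ, hδ, hball⟩ := Metric.nhds_basis_closedBall.mem_iff.1 (mem_interior_iff_mem_nhds.1 hf)
  refine Metric.isCompact_of_isClosed_isBounded ?_ ?_
  · have : {y : E n | ∀ x ∈ C, dot y (x - f) ≤ 1} = ⋂ x ∈ C, {y | dot y (x - f) ≤ 1} := by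
      ext y; simp
    rw [this]
    exact isClosed_biInter fun x _ => isClosed_le (continuous_dot_left _) continuous_const
  · refine (Metric.isBounded_closedBall (x := (0 : E n)) (r := 1 / δ)).subset fun y hy => ?_
    rw [mem_closedBall_zero_iff]
    by_cases h0 : y = 0
    · rw [h0, norm_zero]; positivity
    have hn : 0 < ‖y‖ := norm_pos_iff.2 h0
    have := hy (f + (δ / ‖y‖) • y) (hball (by
      rw [Metric.mem_closedBall, dist_eq_norm, add_sub_cancel_left, norm_smul, Real.norm_eq_abs,
        abs_of_pos (by positivity), div_mul_cancel₀ _ hn.ne']))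
    rw [add_sub_cancel_left, dot_smul_right, dot_self] at this
    rw [le_div_iff₀ hδ]
    have e : δ / ‖y‖ * ‖y‖ ^ 2 = ‖y‖ * δ := by field_simp
    linarith

lemma polar_cover (C : Set (E n)) (hC : Convex ℝ C) (f : E n) (hf : f ∈ interior C) (s : E n)
    (hs : s ∉ interior C) : ∃ y : E n, (∀ x ∈ C, dot y (x - f) ≤ 1) ∧ dot y (s - f) = 1 := by
  obtain ⟨g, hg0, hg⟩ := geometric_hahn_banach_of_nonempty_interior_point hC hs ⟨f, hf⟩
  obtain ⟨z, hz⟩ := exists_dot_of_dual g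
  have hz0 : z ≠ 0 := by
    rintro rfl
    apply hg0
    ext x
    simp [hz, dot_zero_left]
  obtain ⟨δ, hδ, hball⟩ := Metric.nhds_basis_closedBall.mem_iff.1 (mem_interior_iff_mem_nhds.1 hf)
  have hn : 0 < ‖z‖ := norm_pos_iff.2 hz0
  have h1 := hg (f + (δ / ‖z‖) • z) (hball (by
      rw [Metric.mem_closedBall, dist_eq_norm, add_sub_cancel_left, norm_smul, Real.norm_eq_abs,
        abs_of_pos (by positivity), div_mul_cancel₀ _ hn.ne']))
  rw [hz, hz, dot_add_right, dot_smul_right, dot_self] at h1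
  have h2 : 0 < δ / ‖z‖ * ‖z‖ ^ 2 := by positivity
  have h3 : 0 < dot z (s - f) := by rw [dot_sub_right]; linarith
  refine ⟨(dot z (s - f))⁻¹ • z, fun x hx => ?_, ?_⟩
  · have := hg x hx
    rw [hz, hz] at this
    rw [dot_smul_left, inv_mul_le_iff₀ h3, mul_one, dot_sub_right, dot_sub_right]
    linarith
  · rw [dot_smul_left, inv_mul_cancel₀ h3.ne']

lemma khat_cover (C : Set (E n)) (hC : Convex ℝ C) (hcl : IsClosed C) (f : E n)
    (hf : f ∈ interior C) (s : E n)
    (hs : s ∉ interior C) : ∃ y ∈ Khat ((fun x => x - f) '' C), 1 ≤ dot y (s - f) := by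
  have hcont : Continuous (fun t : ℝ => f + t • (s - f)) := by fun_prop
  have hK : IsCompact (Set.Icc (0 : ℝ) 1 ∩ (fun t : ℝ => f + t • (s - f)) ⁻¹' C) :=
    isCompact_Icc.inter_right (hcl.preimage hcont)
  obtain ⟨t, ⟨⟨ht0, ht1⟩, htC⟩, hmax⟩ := hK.exists_isMaxOn
    ⟨0, ⟨le_rfl, zero_le_one⟩, by simpa using interior_subset hf⟩ continuous_id.continuousOn
  have hp : f + t • (s - f) ∉ interior C := by
    intro hin
    rcases ht1.eq_or_lt with rfl | ht1
    · apply hs; simpa using hin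
    · have hev : ∀ᶠ t' in nhdsWithin t (Set.Ioi t), f + t' • (s - f) ∈ C := by
        have : (fun t : ℝ => f + t • (s - f)) ⁻¹' (interior C) ∈ nhds t :=
          (isOpen_interior.preimage hcont).mem_nhds hin
        filter_upwards [nhdsWithin_le_nhds this] with t' ht' using interior_subset ht'
      obtain ⟨t', ht', ht'2⟩ := (hev.and (Ioo_mem_nhdsGT ht1)).exists
      have h := hmax (a := t') ⟨⟨ht0.trans ht'2.1.le, ht'2.2.le⟩, ht'⟩
      have h' : t' ≤ t := h
      linarith [ht'2.1]
  obtain ⟨y, hy, hy1⟩ := polar_cover C hC f hf _ hp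
  refine ⟨y, ⟨?_, f + t • (s - f) - f, ⟨_, htC, rfl⟩, by rw [dot_comm', hy1]⟩, ?_⟩
  · rintro _ ⟨x, hx, rfl⟩
    exact hy x hx
  · rw [add_sub_cancel_left, dot_smul_right] at hy1
    by_contra hcon
    push Not at hcon
    rcases ht0.eq_or_lt with h0 | h0
    · rw [← h0, zero_mul] at hy1
      exact zero_ne_one hy1
    · have := mul_lt_mul_of_pos_left hcon h0
      linarith

lemma bipolar_fin {ι : Type} [Finite ι] [Nonempty ι] (b : ι → E n) (y : E n)
    (hy : ∀ x, (∀ i, dot (b i) x ≤ 1) → dot y x ≤ 1) :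
    ∃ l : ℝ, 0 ≤ l ∧ l ≤ 1 ∧ ∃ a ∈ convexHull ℝ (Set.range b), y = l • a := by
  have hmem : y ∈ convexHull ℝ (insert 0 (Set.range b)) := by
    by_contra hcon
    obtain ⟨g, u, hg, hgy⟩ := geometric_hahn_banach_closed_point
      (convex_convexHull ℝ (insert 0 (Set.range b)))
      (((Set.finite_range b).insert 0).isClosed_convexHull ℝ) hcon
    obtain ⟨z, hz⟩ := exists_dot_of_dual g
    have hu : 0 < u := by
      have := hg 0 (subset_convexHull ℝ _ (Set.mem_insert _ _))
      simpa using this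
    have := hy (u⁻¹ • z) (fun i => by
      have := hg (b i) (subset_convexHull ℝ _ (Set.mem_insert_of_mem _ ⟨i, rfl⟩))
      rw [hz, dot_comm'] at this
      rw [dot_smul_right, inv_mul_le_iff₀ hu]
      linarith)
    rw [dot_smul_right, inv_mul_le_iff₀ hu] at this
    rw [hz, dot_comm'] at hgy
    linarith
  rw [convexHull_insert (Set.range_nonempty b), mem_convexJoin] at hmem
  obtain ⟨x, hx, a, ha, p, q, hp, hq, hpq, h⟩ := hmem
  rw [Set.mem_singleton_iff] at hx
  subst hx
  exact ⟨q, hq, by linarith, a, ha, by simpa using h.symm⟩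

lemma exists_minimal_cover (S : Set (E n)) (f : E n) (D : Set (E n)) (hDc : IsCompact D)
    (hDconv : Convex ℝ D) (hD : ∀ s ∈ S, ∃ a ∈ D, 1 ≤ dot a (s - f)) :
    ∃ A ⊆ D, IsCompact A ∧ Convex ℝ A ∧ (∀ s ∈ S, ∃ a ∈ A, 1 ≤ dot a (s - f)) ∧
      ∀ (ι : Type) [Finite ι] (c : ι → E n), (∀ i, c i ∈ A) →
        (∀ s ∈ S, ∃ i, 1 ≤ dot (c i) (s - f)) → A = convexHull ℝ (Set.range c) := by
  obtain ⟨A, hAD, hA⟩ := zorn_superset_nonempty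
    {A : Set (E n) | IsCompact A ∧ Convex ℝ A ∧ ∀ s ∈ S, ∃ a ∈ A, 1 ≤ dot a (s - f)}
    (by
      intro c hc hchain hne
      obtain ⟨A0, hA0⟩ := hne
      refine ⟨⋂₀ c, ⟨?_, ?_, ?_⟩, fun A hA => Set.sInter_subset_of_mem hA⟩
      · exact (hc hA0).1.of_isClosed_subset (isClosed_sInter fun A hA => (hc hA).1.isClosed)
          (Set.sInter_subset_of_mem hA0)
      · exact convex_sInter fun A hA => (hc hA).2.1
      · intro s hs
        have hcl : IsClosed {a : E n | 1 ≤ dot a (s - f)} :=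
          isClosed_le continuous_const (continuous_dot_left _)
        have : Nonempty c := ⟨⟨A0, hA0⟩⟩
        obtain ⟨a, ha⟩ := IsCompact.nonempty_iInter_of_directed_nonempty_isCompact_isClosed
          (fun A : c => (A : Set (E n)) ∩ {a : E n | 1 ≤ dot a (s - f)})
          (by
            intro A B
            rcases hchain.total A.2 B.2 with h | h
            · exact ⟨A, subset_rfl, Set.inter_subset_inter_left _ h⟩
            · exact ⟨B, Set.inter_subset_inter_left _ h, subset_rfl⟩)
          (fun A => by
            obtain ⟨a, ha, h⟩ := (hc A.2).2.2 s hs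
            exact ⟨a, ha, h⟩)
          (fun A => (hc A.2).1.inter_right hcl)
          (fun A => (hc A.2).1.isClosed.inter hcl)
        rw [Set.mem_iInter] at ha
        exact ⟨a, Set.mem_sInter.2 fun A hA => (ha ⟨A, hA⟩).1, (ha ⟨A0, hA0⟩).2⟩)
    D ⟨hDc, hDconv, hD⟩
  refine ⟨A, hAD, hA.prop.1, hA.prop.2.1, hA.prop.2.2, fun ι _ c hcA hcov => ?_⟩
  have hsub : convexHull ℝ (Set.range c) ⊆ A :=
    convexHull_min (Set.range_subset_iff.2 hcA) hA.prop.2.1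
  refine hA.eq_of_superset (t := convexHull ℝ (Set.range c)) ⟨(Set.finite_range c).isCompact_convexHull ℝ,
    convex_convexHull ℝ _, fun s hs => ?_⟩ hsub
  obtain ⟨i, hi⟩ := hcov s hs
  exact ⟨c i, subset_convexHull ℝ _ ⟨i, rfl⟩, hi⟩

lemma numeric_bound {κ : Type*} [Fintype κ] (p w : κ → ℝ) (hw : ∀ k, 1 ≤ w k) (M0 : ℝ)
    (hM0 : 0 ≤ M0) (hsum : -M0 ≤ ∑ k, w k * p k) (δ m : ℝ) (hδ : 0 < δ) (hm0 : 0 ≤ m)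
    (hpm : ∀ k, p k ≤ 2 + 2 * δ * m) (hm : m = 0 ∨ ∃ j, p j = -m)
    (hδW : 4 * δ * ∑ k, w k ≤ 1) : m ≤ 2 * M0 + 4 * ∑ k, w k := by
  have hW : 0 ≤ ∑ k, w k := Finset.sum_nonneg fun k _ => zero_le_one.trans (hw k)
  rcases hm with rfl | ⟨j, hj⟩
  · positivity
  have h1 : w j * (2 + 2 * δ * m - p j) ≤ ∑ k, w k * (2 + 2 * δ * m - p k) :=
    Finset.single_le_sum (f := fun k => w k * (2 + 2 * δ * m - p k))
      (fun k _ => mul_nonneg (zero_le_one.trans (hw k)) (by linarith [hpm k])) (Finset.mem_univ j)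
  have h2 : ∑ k, w k * (2 + 2 * δ * m - p k) =
      (∑ k, w k) * (2 + 2 * δ * m) - ∑ k, w k * p k := by
    rw [Finset.sum_mul, ← Finset.sum_sub_distrib]
    exact Finset.sum_congr rfl fun k _ => by ring
  have h3 : m ≤ w j * (2 + 2 * δ * m - p j) := by
    rw [hj]
    have h4 : 0 ≤ δ * m := by positivity
    nlinarith [hw j]
  have h5 : 2 * δ * (∑ k, w k) * m ≤ m / 2 := by nlinarith
  nlinarith

end Polar

section Core
variable {n : ℕ}

lemma dot_neg_right (x y : E n) : dot x (-y) = - dot x y := by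
  simp [dot_eq_inner]

lemma convex_le_dot (v : E n) (c : ℝ) : Convex ℝ {a : E n | c ≤ dot a v} := by
  have h := convex_dot_le (-v) (-c)
  simpa only [dot_neg_right, neg_le_neg_iff] using h

lemma core_max {m : ℕ} (α : Fin m → E n) (β : Fin m → ℝ) (hα : ∀ l, IsRatVec (α l))
    (S : Set (E n)) (hS : S = {x | IsIntPt x ∧ ∀ l, dot (α l) x ≤ β l}) (hne : S.Nonempty)
    (f : E n) (hf : f ∈ convexHull ℝ S) (A : Set (E n)) (hAc : IsCompact A) (hAconv : Convex ℝ A)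
    (hdoi : ∀ D : Set (E n), IsCompact D → (∀ s ∈ S, ∃ a ∈ D, 1 ≤ dot a (s - f)) →
      ∃ b : Fin (2 ^ n) → E n, (∀ i, b i ∈ D) ∧ ∀ s ∈ S, ∃ i, 1 ≤ dot (b i) (s - f))
    (hmin : ∀ (ι : Type) [Finite ι] (c : ι → E n), (∀ i, c i ∈ A) →
        (∀ s ∈ S, ∃ i, 1 ≤ dot (c i) (s - f)) → A = convexHull ℝ (Set.range c))
    (b : Fin (2 ^ n) → E n) (hbA : ∀ i, b i ∈ A) (hbcov : ∀ s ∈ S, ∃ i, 1 ≤ dot (b i) (s - f))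
    (C : Set (E n)) (hC : Convex ℝ C) (hfree : SFree S C) (hfC : f ∈ interior C)
    (hsub : {x | ∀ i, dot (b i) (x - f) ≤ 1} ⊆ C) :
    C ⊆ {x | ∀ i, dot (b i) (x - f) ≤ 1} := by
  classical
  intro x hxC
  by_contra hxB
  obtain ⟨i0, hi0⟩ : ∃ i0, 1 < dot (b i0) (x - f) := by
    by_contra hcon
    push Not at hcon
    exact hxB hcon
  have hAb := hmin _ b hbA hbcov
  -- two distinct points
  obtain ⟨a1, ha1, a2, ha2, hne12⟩ : ∃ a1 ∈ A, ∃ a2 ∈ A, a1 ≠ a2 := by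
    by_contra hcon
    push Not at hcon
    have hsubS : S ⊆ {x | dot (b i0) f + 1 ≤ dotL (b i0) x} := by
      intro s hs
      obtain ⟨i, hi⟩ := hbcov s hs
      rw [hcon (b i) (hbA i) (b i0) (hbA i0), dot_sub_right] at hi
      change _ ≤ dot (b i0) s
      linarith
    have := convexHull_min hsubS (convex_halfSpace_ge (dotL (b i0)).isLinear _) hf
    change _ ≤ dot (b i0) f at this
    linarith
  -- perturbation
  obtain ⟨x', hx'C, ⟨a, haA, hax'⟩, hne'⟩ : ∃ x' ∈ C, (∃ a ∈ A, 1 < dot a (x' - f)) ∧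
      dot a1 (x' - f) ≠ dot a2 (x' - f) := by
    by_cases hx12 : dot a1 (x - f) = dot a2 (x - f)
    · have h1 : ∀ᶠ η in nhdsWithin (0 : ℝ) (Set.Ioi 0), f + η • (a1 - a2) ∈ C := by
        have hcont : Continuous (fun η : ℝ => f + η • (a1 - a2)) := by fun_prop
        have : (fun η : ℝ => f + η • (a1 - a2)) ⁻¹' (interior C) ∈ nhds (0 : ℝ) :=
          (isOpen_interior.preimage hcont).mem_nhds (by simpa using hfC)
        filter_upwards [nhdsWithin_le_nhds this] with t' ht' using interior_subset ht'
      obtain ⟨η, hη, hη0⟩ := (h1.and self_mem_nhdsWithin).exists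
      have hη0 : 0 < η := hη0
      have h2 : ∀ᶠ e in nhdsWithin (0 : ℝ) (Set.Ioi 0),
          1 < (1 - e) * dot (b i0) (x - f) + e * (η * dot (b i0) (a1 - a2)) := by
        have hcont : Continuous (fun e : ℝ =>
          (1 - e) * dot (b i0) (x - f) + e * (η * dot (b i0) (a1 - a2))) := by fun_prop
        have := (isOpen_Ioi (a := (1 : ℝ))).preimage hcont |>.mem_nhds (x := (0 : ℝ))
          (by simpa using hi0)
        filter_upwards [nhdsWithin_le_nhds this] with t' ht' using ht'
      obtain ⟨e, he, he0, he1⟩ := (h2.and (Ioo_mem_nhdsGT one_pos)).exists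
      have hdec : (1 - e) • x + e • (f + η • (a1 - a2)) - f =
          (1 - e) • (x - f) + e • (η • (a1 - a2)) := by module
      refine ⟨(1 - e) • x + e • (f + η • (a1 - a2)),
        hC hxC hη (by linarith) he0.le (by ring), ⟨b i0, hbA i0, ?_⟩, ?_⟩
      · rw [hdec, dot_add_right, dot_smul_right, dot_smul_right, dot_smul_right]
        exact he
      · rw [hdec]
        intro h
        simp only [dot_add_right, dot_smul_right] at h
        rw [hx12] at h
        have h3 : e * (η * (dot a1 (a1 - a2) - dot a2 (a1 - a2))) = 0 := by linarith
        rw [← dot_sub_left, dot_self] at h3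
        have h4 : 0 < ‖a1 - a2‖ := norm_pos_iff.2 (sub_ne_zero.2 hne12)
        have : 0 < e * (η * ‖a1 - a2‖ ^ 2) := by positivity
        linarith
    · exact ⟨x, hxC, ⟨b i0, hbA i0, hi0⟩, hx12⟩
  obtain ⟨aM, haM, hmax⟩ := hAc.exists_isMaxOn ⟨a, haA⟩ (continuous_dot_left (x' - f)).continuousOn
  have hmax' : ∀ a ∈ A, dot a (x' - f) ≤ dot aM (x' - f) := fun a ha => hmax ha
  have hM1 : 1 < dot aM (x' - f) := hax'.trans_le (hmax' a haA)
  obtain ⟨d, hdA, hdM⟩ : ∃ d ∈ A, dot d (x' - f) < dot aM (x' - f) := by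
    rcases lt_or_gt_of_ne hne' with h | h
    · exact ⟨a1, ha1, h.trans_le (hmax' a2 ha2)⟩
    · exact ⟨a2, ha2, h.trans_le (hmax' a1 ha1)⟩
  -- the tuple from C
  obtain ⟨y, hyC, hycov⟩ := hdoi _ (polar_compact C f hfC) (fun s hs => by
    obtain ⟨y, hy, h⟩ := polar_cover C hC f hfC s (fun h => hfree s h hs)
    exact ⟨y, hy, h.ge⟩)
  have hdecomp : ∀ k, ∃ l : ℝ, 0 ≤ l ∧ l ≤ 1 ∧ ∃ a ∈ A, y k = l • a := by
    intro k
    rw [hAb]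
    have : Nonempty (Fin (2 ^ n)) := ⟨i0⟩
    refine bipolar_fin b (y k) fun z hz => ?_
    have := hyC k (z + f) (hsub (fun i => by simpa using hz i))
    simpa using this
  choose l hl0 hl1 c hcA hyc using hdecomp
  have hlcov : ∀ s ∈ S, ∃ k, 1 ≤ l k * dot (c k) (s - f) := by
    intro s hs
    obtain ⟨k, hk⟩ := hycov s hs
    exact ⟨k, by rwa [hyc, dot_smul_left] at hk⟩
  have hccov : ∀ s ∈ S, ∃ k, 1 ≤ dot (c k) (s - f) := by
    intro s hs
    obtain ⟨k, hk⟩ := hlcov s hs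
    refine ⟨k, ?_⟩
    by_contra hcon
    push Not at hcon
    rcases (hl0 k).eq_or_lt with h0 | h0
    · rw [← h0, zero_mul] at hk; linarith
    · have := mul_lt_mul_of_pos_left hcon h0
      linarith [hl1 k]
  have hAcv := hmin _ c hcA hccov
  -- recession directions
  have hR : ∀ r, (∀ l, dot (α l) r ≤ 0) → (∀ k, dot (c k) r ≤ 0) → ∀ k, dot (c k) r = 0 := by
    intro r hr1 hr2 k
    have hA0 := hmin {k // dot (c k) r = 0} (fun k => c k.1) (fun k => hcA k.1) (fun s hs => by
      have hs' := hs
      rw [hS] at hs'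
      obtain ⟨j, hj, h⟩ := rec_cover α β hα f c
        (fun s h1 h2 => hccov s (by rw [hS]; exact ⟨h1, h2⟩)) r hr1 hr2 s hs'.1 hs'.2
      exact ⟨⟨j, hj⟩, h⟩)
    have hk : c k ∈ {a : E n | 0 ≤ dot a r} := by
      have := hcA k
      rw [hA0] at this
      refine convexHull_min ?_ (convex_le_dot r 0) this
      rintro _ ⟨j, rfl⟩
      exact j.2.ge
    exact le_antisymm (hr2 k) hk
  obtain ⟨μ, hμ0, hμ⟩ := farkas_finset Finset.univ
    (Sum.elim (fun l => dotL (α l)) (fun k => dotL (c k))) (-∑ k, dotL (c k)) (by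
      intro r hr
      have h := hR r (fun l => hr (Sum.inl l) (Finset.mem_univ _))
        (fun k => hr (Sum.inr k) (Finset.mem_univ _))
      have h' : ∀ k, dotL (c k) r = 0 := h
      simp [LinearMap.sum_apply, h'])
  have hμ' : ∀ r, ∑ k, (1 + μ (Sum.inr k)) * dot (c k) r = -∑ l, μ (Sum.inl l) * dot (α l) r := by
    intro r
    have h := hμ r
    rw [Fintype.sum_sum_type] at h
    simp only [LinearMap.neg_apply, LinearMap.sum_apply, Sum.elim_inl, Sum.elim_inr] at h
    change -∑ k, dot (c k) r = ∑ l, μ (Sum.inl l) * dot (α l) r +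
      ∑ k, μ (Sum.inr k) * dot (c k) r at h
    simp only [add_mul, one_mul, Finset.sum_add_distrib]
    linarith
  set W : ℝ := ∑ k, (1 + μ (Sum.inr k)) with hWdef
  set M0 : ℝ := ∑ l, μ (Sum.inl l) * |β l - dot (α l) f| with hM0def
  have hW0 : 0 ≤ W := Finset.sum_nonneg fun k _ => by linarith [hμ0 (Sum.inr k)]
  have hM00 : 0 ≤ M0 := Finset.sum_nonneg fun l _ => mul_nonneg (hμ0 _) (abs_nonneg _)
  obtain ⟨c0, hc0, hc0'⟩ := exists_pos_le_all (fun k => if l k < 1 then 1 - l k else 1)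
    (fun k => by split_ifs with h <;> linarith)
  obtain ⟨δ, hδ0, hδ1, hδ2, hδ3⟩ : ∃ δ : ℝ, 0 < δ ∧ δ ≤ 1 / 2 ∧ 4 * δ * W ≤ 1 ∧
      δ * (1 + c0 + (2 * M0 + 4 * W)) ≤ c0 := by
    refine ⟨min (1 / 2) (min (1 / (4 * W + 1)) (c0 / (1 + c0 + (2 * M0 + 4 * W)))), ?_,
      min_le_left _ _, ?_, ?_⟩
    · refine lt_min (by norm_num) (lt_min (by positivity) (by positivity))
    · have h := (min_le_right (1 / 2 : ℝ) _).trans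
        (min_le_left (1 / (4 * W + 1)) (c0 / (1 + c0 + (2 * M0 + 4 * W))))
      set δ := min (1 / 2) (min (1 / (4 * W + 1)) (c0 / (1 + c0 + (2 * M0 + 4 * W)))) with hδ
      have hδ0 : 0 < δ := lt_min (by norm_num) (lt_min (by positivity) (by positivity))
      rw [le_div_iff₀ (by positivity)] at h
      linarith
    · have h := (min_le_right (1 / 2 : ℝ) _).trans
        (min_le_right (1 / (4 * W + 1)) (c0 / (1 + c0 + (2 * M0 + 4 * W))))
      rwa [le_div_iff₀ (by positivity)] at h
  -- the shrunk family
  let c' : Fin (2 ^ n) → E n := fun k => if l k < 1 then (1 - δ) • c k + δ • d else c k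
  have hc'A : ∀ k, c' k ∈ A := by
    intro k
    dsimp only [c']
    split_ifs
    · exact hAconv (hcA k) hdA (by linarith) hδ0.le (by ring)
    · exact hcA k
  have hc'M : ∀ k, dot (c' k) (x' - f) < dot aM (x' - f) := by
    intro k
    dsimp only [c']
    split_ifs with h
    · rw [dot_add_left, dot_smul_left, dot_smul_left]
      have h1 := mul_le_mul_of_nonneg_left (hmax' _ (hcA k)) (by linarith : (0 : ℝ) ≤ 1 - δ)
      have h2 := mul_lt_mul_of_pos_left hdM hδ0
      linarith
    · have h1 : l k = 1 := le_antisymm (hl1 k) (not_lt.1 h)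
      have h2 := hyC k x' hx'C
      rw [hyc, h1, one_smul] at h2
      linarith
  obtain ⟨s, hsS, hs⟩ : ∃ s ∈ S, ∀ k, dot (c' k) (s - f) < 1 := by
    by_contra hcon
    push Not at hcon
    have h := hmin _ c' hc'A hcon
    have haM' := haM
    rw [h] at haM'
    have : aM ∈ {a : E n | dot a (x' - f) < dot aM (x' - f)} := by
      refine convexHull_min ?_ (convex_dot_lt _ _) haM'
      rintro _ ⟨j, rfl⟩
      exact hc'M j
    exact lt_irrefl (dot aM (x' - f)) this
  -- the contradiction
  have hsα : ∀ l, dot (α l) s ≤ β l := by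
    have := hsS
    rw [hS] at this
    exact this.2
  have : Nonempty (Fin (2 ^ n)) := ⟨i0⟩
  obtain ⟨j0, hj0⟩ := Finite.exists_min (fun k => dot (c k) (s - f))
  set mm : ℝ := max 0 (-dot (c j0) (s - f)) with hmm
  have hmm0 : 0 ≤ mm := le_max_left _ _
  have hmm1 : -dot (c j0) (s - f) ≤ mm := le_max_right _ _
  have hd : -mm ≤ dot d (s - f) := by
    have hdA' := hdA
    rw [hAcv] at hdA'
    have : d ∈ {a : E n | -mm ≤ dot a (s - f)} := by
      refine convexHull_min ?_ (convex_le_dot _ _) hdA'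
      rintro _ ⟨j, rfl⟩
      have := hj0 j
      change -mm ≤ dot (c j) (s - f)
      linarith
    exact this
  have hδmm : 0 ≤ δ * mm := by positivity
  have hstep : ∀ k, l k < 1 → (1 - δ) * dot (c k) (s - f) < 1 + δ * mm := by
    intro k hk
    have h := hs k
    dsimp only [c'] at h
    rw [if_pos hk, dot_add_left, dot_smul_left, dot_smul_left] at h
    have := mul_le_mul_of_nonneg_left hd hδ0.le
    linarith
  have hpm : ∀ k, dot (c k) (s - f) ≤ 2 + 2 * δ * mm := by
    intro k
    by_cases hk : l k < 1
    · have h := hstep k hk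
      by_contra hcon
      push Not at hcon
      nlinarith
    · have h := hs k
      dsimp only [c'] at h
      rw [if_neg hk] at h
      linarith
  have hsum : -M0 ≤ ∑ k, (1 + μ (Sum.inr k)) * dot (c k) (s - f) := by
    rw [hμ', neg_le_neg_iff]
    refine Finset.sum_le_sum fun l _ => mul_le_mul_of_nonneg_left ?_ (hμ0 _)
    rw [dot_sub_right]
    have := le_abs_self (β l - dot (α l) f)
    linarith [hsα l]
  have hbound := numeric_bound (fun k => dot (c k) (s - f)) (fun k => 1 + μ (Sum.inr k))
    (fun k => by linarith [hμ0 (Sum.inr k)]) M0 hM00 hsum δ mm hδ0 hmm0 hpm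
    (by
      rcases max_choice 0 (-dot (c j0) (s - f)) with h | h
      · left; rw [hmm, h]
      · right; exact ⟨j0, by rw [hmm, h, neg_neg]⟩) hδ2
  obtain ⟨k, hk⟩ := hlcov s hsS
  by_cases hk1 : l k < 1
  · have h1 := hstep k hk1
    have h2 := hc0' k
    rw [if_pos hk1] at h2
    have hlpos : 0 < l k := by
      rcases (hl0 k).eq_or_lt with h0 | h0
      · rw [← h0, zero_mul] at hk; linarith
      · exact h0
    have h3 : 1 + c0 ≤ dot (c k) (s - f) := by
      by_contra hcon
      push Not at hcon
      have h4 := mul_lt_mul_of_pos_left hcon hlpos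
      nlinarith
    have h5 := mul_le_mul_of_nonneg_left h3 (by linarith : (0 : ℝ) ≤ 1 - δ)
    have h6 := mul_le_mul_of_nonneg_left hbound hδ0.le
    nlinarith
  · have h := hs k
    dsimp only [c'] at h
    rw [if_neg hk1] at h
    have h1 : l k = 1 := le_antisymm (hl1 k) (not_lt.1 hk1)
    rw [h1, one_mul] at hk
    linarith

end Core

/-- For a closed S-free convex set C with f in its interior and K = C - f,
there is a maximal S-free convex set of the form {x | aᵢ·(x-f) ≤ 1, i = 1,…,k}
with each aᵢ ∈ cl(conv(K̂)). -/
theorem stmt_15 {n : ℕ} (S : Set (E n)) (hS : IsIntPtsOfRatPolyhedron S)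
    (hdim : FullDimSet S) (f : E n) (hf : f ∈ convexHull ℝ S) (hfi : ¬ IsIntPt f)
    (C : Set (E n)) (hcl : IsClosed C) (hconv : Convex ℝ C)
    (hfree : SFree S C) (hfC : f ∈ interior C) :
    ∃ (k : ℕ) (a : Fin (k + 1) → E n),
      (∀ i, a i ∈ closure (convexHull ℝ (Khat ((fun x => x - f) '' C)))) ∧
      MaxSFree S {x : E n | ∀ i, dot (a i) (x - f) ≤ 1} := by
  obtain ⟨m, α, β, hα, -, hSe⟩ := hS
  have hne : S.Nonempty := by
    obtain ⟨p, hp, -⟩ := hdim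
    exact ⟨p 0, hp 0⟩
  have hintPt : ∀ s ∈ S, IsIntPt s := fun s hs => by rw [hSe] at hs; exact hs.1
  have hmid : ∀ x ∈ S, ∀ y ∈ S, IsIntPt ((1/2 : ℝ) • (x + y)) → (1/2 : ℝ) • (x + y) ∈ S := by
    intro x hx y hy h
    rw [hSe] at hx hy ⊢
    refine ⟨h, fun l => ?_⟩
    rw [dot_smul_right, dot_add_right]
    linarith [hx.2 l, hy.2 l]
  have hdoi := fun (D : Set (E n)) (hD : IsCompact D) => doignon S hintPt hmid hne f D hD
  have hDP : closure (convexHull ℝ (Khat ((fun x => x - f) '' C))) ⊆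
      {y : E n | ∀ x ∈ C, dot y (x - f) ≤ 1} := by
    refine closure_minimal (convexHull_min ?_ ?_) (polar_compact C f hfC).isClosed
    · rintro y ⟨hy, -⟩ x hx
      exact hy _ ⟨x, hx, rfl⟩
    · have : {y : E n | ∀ x ∈ C, dot y (x - f) ≤ 1} = ⋂ x ∈ C, {y | dot y (x - f) ≤ 1} := by
        ext y; simp
      rw [this]
      exact convex_iInter₂ fun x _ => convex_dot_le _ _
  obtain ⟨A, hAD, hAc, hAconv, hAcov, hmin⟩ := exists_minimal_cover S f
    (closure (convexHull ℝ (Khat ((fun x => x - f) '' C))))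
    ((polar_compact C f hfC).of_isClosed_subset isClosed_closure hDP)
    (convex_convexHull ℝ _).closure
    (fun s hs => by
      obtain ⟨y, hy, h⟩ := khat_cover C hconv hcl f hfC s (fun h => hfree s h hs)
      exact ⟨y, subset_closure (subset_convexHull ℝ _ hy), h⟩)
  obtain ⟨b, hbA, hbcov⟩ := hdoi A hAc hAcov
  have hBmax : MaxSFree S {x : E n | ∀ i, dot (b i) (x - f) ≤ 1} := by
    refine ⟨?_, ?_, ?_⟩
    · intro x hx y hy p q hp hq hpq i
      have h1 := mul_le_mul_of_nonneg_left (hx i) hp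
      have h2 := mul_le_mul_of_nonneg_left (hy i) hq
      have h3 : p • x + q • y - f = p • (x - f) + q • (y - f) := by
        have : f = (p + q) • f := by rw [hpq, one_smul]
        nth_rewrite 1 [this]
        module
      rw [h3, dot_add_right, dot_smul_right, dot_smul_right]
      linarith
    · intro x hx hxS
      obtain ⟨i, hi⟩ := hbcov x hxS
      have hcont : Continuous (fun e : ℝ => x + e • (x - f)) := by fun_prop
      have : (fun e : ℝ => x + e • (x - f)) ⁻¹'
          (interior {x : E n | ∀ i, dot (b i) (x - f) ≤ 1}) ∈ nhds (0 : ℝ) :=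
        (isOpen_interior.preimage hcont).mem_nhds (by simpa using hx)
      obtain ⟨e, he, he0⟩ := (Filter.Eventually.and
        (nhdsWithin_le_nhds (s := Set.Ioi (0 : ℝ)) this) self_mem_nhdsWithin).exists
      have he0 : 0 < e := he0
      have h := interior_subset he i
      have h3 : x + e • (x - f) - f = (1 + e) • (x - f) := by module
      rw [h3, dot_smul_right] at h
      nlinarith
    · intro C' hC' hfree' hsub
      have hCB : C ⊆ {x : E n | ∀ i, dot (b i) (x - f) ≤ 1} :=
        fun x hx i => hDP (hAD (hbA i)) x hx
      exact hsub.antisymm (core_max α β hα S hSe hne f hf A hAc hAconv hdoi hmin b hbA hbcov C' hC'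
        hfree' (interior_mono (hCB.trans hsub) hfC) hsub)
  have hk : 2 ^ n = (2 ^ n - 1) + 1 := by
    have : 0 < 2 ^ n := by positivity
    omega
  refine ⟨2 ^ n - 1, fun i => b (Fin.cast hk.symm i), fun i => hAD (hbA _), ?_⟩
  convert hBmax using 1
  ext x
  constructor
  · intro h i
    have := h (Fin.cast hk i)
    simpa using this
  · intro h i
    exact h _
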